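/- For every odd integer n ≥ 17, σ(n) < (2/3) · e^γ · n · log(log(2n)). -/

import Mathlib

open Real Finset

/-! ### Kernel computation with primes below `2 ^ 14` -/

/-- `127!`, as a closed numeral computed by the kernel. -/
def bigFac : ℕ := Nat.factorial 127

/-- A primality test valid below `2 ^ 14`. -/
def isP (i : ℕ) : Bool :=
  cond (Nat.ble i 127) (cond (Nat.ble 2 i) (Nat.beq (Nat.gcd i (Nat.factorial (i - 1))) 1) false)
    (Nat.beq (Nat.gcd i bigFac) 1)

lemma isP_iff (i : ℕ) (hi : i < 16384) : isP i = true ↔ i.Prime := by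
  unfold isP
  by_cases h : i ≤ 127
  · rw [Nat.ble_eq_true_of_le h, cond_true]
    by_cases h2 : 2 ≤ i
    · rw [Nat.ble_eq_true_of_le h2, cond_true]
      rw [Nat.beq_eq]
      constructor
      · intro hg
        by_contra hp
        have h3 := Nat.minFac_prime (show i ≠ 1 by omega)
        have h4 : i.minFac < i := by
          refine lt_of_le_of_ne (Nat.minFac_le (by omega)) ?_
          intro h5
          rw [h5] at h3
          exact hp h3
        have h5 : i.minFac ∣ Nat.gcd i (Nat.factorial (i - 1)) :=
          Nat.dvd_gcd (Nat.minFac_dvd i) ((h3.dvd_factorial).2 (by omega))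
        rw [hg] at h5
        exact h3.one_lt.ne' (Nat.dvd_one.1 h5)
      · intro hp
        refine (hp.coprime_iff_not_dvd).2 ?_
        intro hd
        have := (hp.dvd_factorial).1 hd
        omega
    · have : Nat.ble 2 i = false := by
        rw [← Bool.not_eq_true, Nat.ble_eq]; exact h2
      rw [this, cond_false]
      constructor
      · intro h; cases h
      · intro hp; exact absurd hp.two_le h2
  · have : Nat.ble i 127 = false := by
      rw [← Bool.not_eq_true, Nat.ble_eq]; exact h
    rw [this, cond_false, Nat.beq_eq]
    unfold bigFac
    constructor
    · intro hg
      by_contra hp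
      have h3 := Nat.minFac_prime (show i ≠ 1 by omega)
      have h4 : i.minFac ^ 2 ≤ i := Nat.minFac_sq_le_self (by omega) hp
      have h6 : i.minFac ≤ 127 := by
        by_contra h7
        have : 128 ^ 2 ≤ i.minFac ^ 2 := Nat.pow_le_pow_left (by omega) 2
        omega
      have h5 : i.minFac ∣ Nat.gcd i (Nat.factorial 127) :=
        Nat.dvd_gcd (Nat.minFac_dvd i) ((h3.dvd_factorial).2 h6)
      rw [hg] at h5
      exact h3.one_lt.ne' (Nat.dvd_one.1 h5)
    · intro hp
      refine (hp.coprime_iff_not_dvd).2 ?_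
      intro hd
      have := (hp.dvd_factorial).1 hd
      omega

/-- product of the primes in `[lo, lo + 2 ^ k)`. -/
def numT : ℕ → ℕ → ℕ
  | 0, lo => cond (isP lo) lo 1
  | k + 1, lo => numT k lo * numT k (lo + 2 ^ k)

/-- product of `p - 1` for the primes in `[lo, lo + 2 ^ k)`. -/
def denT : ℕ → ℕ → ℕ
  | 0, lo => cond (isP lo) (lo - 1) 1
  | k + 1, lo => denT k lo * denT k (lo + 2 ^ k)

lemma numT_eq (k : ℕ) : ∀ lo : ℕ, lo + 2 ^ k ≤ 16384 →
    numT k lo = ∏ p ∈ (Ico lo (lo + 2 ^ k)).filter Nat.Prime, p := by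
  induction k with
  | zero =>
    intro lo h
    have := isP_iff lo (by simp at h; omega)
    simp only [numT, pow_zero, Nat.Ico_succ_singleton, Finset.filter_singleton]
    by_cases hp : lo.Prime
    · simp [hp, this.2 hp]
    · have h2 : isP lo = false := by rw [← Bool.not_eq_true, this]; exact hp
      simp [hp, h2]
  | succ k ih =>
    intro lo h
    rw [pow_succ] at h
    have h1 : lo + 2 ^ (k + 1) = lo + 2 ^ k + 2 ^ k := by rw [pow_succ]; ring
    simp only [numT]
    rw [ih lo (by omega), ih (lo + 2 ^ k) (by omega), h1, Finset.prod_filter, Finset.prod_filter,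
      Finset.prod_filter, Finset.prod_Ico_consecutive _ (by omega) (by omega)]

lemma denT_eq (k : ℕ) : ∀ lo : ℕ, lo + 2 ^ k ≤ 16384 →
    denT k lo = ∏ p ∈ (Ico lo (lo + 2 ^ k)).filter Nat.Prime, (p - 1) := by
  induction k with
  | zero =>
    intro lo h
    have := isP_iff lo (by simp at h; omega)
    simp only [denT, pow_zero, Nat.Ico_succ_singleton, Finset.filter_singleton]
    by_cases hp : lo.Prime
    · simp [hp, this.2 hp]
    · have h2 : isP lo = false := by rw [← Bool.not_eq_true, this]; exact hp
      simp [hp, h2]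
  | succ k ih =>
    intro lo h
    rw [pow_succ] at h
    have h1 : lo + 2 ^ (k + 1) = lo + 2 ^ k + 2 ^ k := by rw [pow_succ]; ring
    simp only [denT]
    rw [ih lo (by omega), ih (lo + 2 ^ k) (by omega), h1, Finset.prod_filter, Finset.prod_filter,
      Finset.prod_filter, Finset.prod_Ico_consecutive _ (by omega) (by omega)]

set_option maxRecDepth 100000 in
lemma comp_den : numT 7 0 * 1000 ≤ 8783 * denT 7 0 ∧
    numT 8 0 * 1000 ≤ 9965 * denT 8 0 ∧ numT 9 0 * 1000 ≤ 11204 * denT 9 0 ∧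
    numT 10 0 * 1000 ≤ 12400 * denT 10 0 ∧ numT 11 0 * 1000 ≤ 13615 * denT 11 0 ∧
    numT 12 0 * 1000 ≤ 14847 * denT 12 0 ∧ numT 13 0 * 1000 ≤ 16065 * denT 13 0 ∧
    numT 14 0 * 1000 ≤ 17300 * denT 14 0 := by
  decide +kernel

set_option maxRecDepth 100000 in
set_option exponentiation.threshold 100000 in
lemma comp_num : 2 ^ 76 ≤ numT 6 0 ∧ 2 ^ 161 ≤ numT 7 0 ∧ 2 ^ 334 ≤ numT 8 0 ∧
    2 ^ 702 ≤ numT 9 0 ∧ 2 ^ 1410 ≤ numT 10 0 ∧ 2 ^ 2860 ≤ numT 11 0 ∧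
    2 ^ 5800 ≤ numT 12 0 ∧ 2 ^ 11600 ≤ numT 13 0 := by
  decide +kernel

/-! ### Numerical bounds -/

lemma log_lb (x : ℝ) (hx : 0 < x) (a b : ℕ) (hb : 0 < b)
    (h : (2.7182818286 : ℝ) ^ a ≤ x ^ b) : (a : ℝ) / b ≤ Real.log x := by
  have h1 : Real.exp a ≤ x ^ b := by
    have : Real.exp a = Real.exp 1 ^ a := by rw [← Real.exp_nat_mul]; simp
    rw [this]
    refine le_trans (pow_le_pow_left₀ (Real.exp_pos 1).le Real.exp_one_lt_d9.le a) h
  have h2 := (Real.le_log_iff_exp_le (by positivity)).2 h1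
  rw [Real.log_pow] at h2
  rw [div_le_iff₀ (by exact_mod_cast hb)]
  linarith

lemma log_ub (x : ℝ) (hx : 0 < x) (a b : ℕ) (hb : 0 < b)
    (h : x ^ b ≤ (2.7182818283 : ℝ) ^ a) : Real.log x ≤ (a : ℝ) / b := by
  have h1 : x ^ b ≤ Real.exp a := by
    have : Real.exp a = Real.exp 1 ^ a := by rw [← Real.exp_nat_mul]; simp
    rw [this]
    exact le_trans h (pow_le_pow_left₀ (by norm_num) Real.exp_one_gt_d9.le a)
  have h2 := (Real.log_le_iff_le_exp (by positivity)).2 h1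
  rw [Real.log_pow] at h2
  rw [le_div_iff₀ (by exact_mod_cast hb)]
  linarith

lemma gamma_lb : (14 : ℝ) / 25 < Real.eulerMascheroniConstant := by
  refine lt_trans ?_ (Real.eulerMascheroniSeq_lt_eulerMascheroniConstant 30)
  have h := log_ub 31 (by norm_num) 79 23 (by norm_num) (by norm_num)
  have h2 : ((harmonic 30 : ℚ) : ℝ) > 3.9949 := by
    have : (harmonic 30 : ℚ) > 3.9949 := by
      norm_num [harmonic, Finset.sum_range_succ]
    have h3 : (((3.9949 : ℚ)) : ℝ) < ((harmonic 30 : ℚ) : ℝ) := by exact_mod_cast this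
    refine lt_of_eq_of_lt ?_ h3
    norm_num
  unfold Real.eulerMascheroniSeq
  norm_num at h h2 ⊢
  linarith

lemma exp_gamma_lb : (7 : ℝ) / 4 ≤ Real.exp Real.eulerMascheroniConstant := by
  have h := log_ub (7 / 4) (by norm_num) 14 25 (by norm_num) (by norm_num)
  rw [← Real.log_le_iff_le_exp (by norm_num)]
  have := gamma_lb
  norm_num at h
  linarith

/-! ### The Mertens product and Chebyshev function -/

/-- logarithm of the Mertens product -/
noncomputable def mG (x : ℕ) : ℝ := ∑ p ∈ Nat.primesLE x, Real.log ((p : ℝ) / (p - 1))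

/-- Chebyshev theta -/
noncomputable def mTh (x : ℕ) : ℝ := ∑ p ∈ Nat.primesLE x, Real.log (p : ℝ)

lemma log_frac_nonneg (p : ℕ) (hp : p.Prime) : 0 ≤ Real.log ((p : ℝ) / (p - 1)) := by
  have : (2 : ℝ) ≤ p := by exact_mod_cast hp.two_le
  apply Real.log_nonneg
  rw [le_div_iff₀ (by linarith)]
  linarith

lemma mG_mono {a b : ℕ} (h : a ≤ b) : mG a ≤ mG b := by
  unfold mG
  refine Finset.sum_le_sum_of_subset_of_nonneg (Nat.primesLE_mono h) ?_
  intro p hp _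
  exact log_frac_nonneg p (Nat.prime_of_mem_primesLE hp)

lemma mTh_mono {a b : ℕ} (h : a ≤ b) : mTh a ≤ mTh b := by
  unfold mTh
  refine Finset.sum_le_sum_of_subset_of_nonneg (Nat.primesLE_mono h) ?_
  intro p hp _
  exact Real.log_nonneg (by exact_mod_cast (Nat.prime_of_mem_primesLE hp).one_le)

lemma mTh_eq (x : ℕ) : mTh x = Real.log ((∏ p ∈ Nat.primesLE x, p : ℕ) : ℝ) := by
  unfold mTh
  rw [Nat.cast_prod, Real.log_prod]
  intro p hp
  exact_mod_cast (Nat.prime_of_mem_primesLE hp).ne_zero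

lemma mG_le (x : ℕ) (c : ℝ) (h : ((∏ p ∈ Nat.primesLE x, p : ℕ) : ℝ) ≤
    c * ((∏ p ∈ Nat.primesLE x, (p - 1) : ℕ) : ℝ)) : Real.exp (mG x) ≤ c := by
  have hpos : (0 : ℝ) < ((∏ p ∈ Nat.primesLE x, (p - 1) : ℕ) : ℝ) := by
    rw [Nat.cast_pos]
    refine Finset.prod_pos ?_
    intro p hp
    have := (Nat.prime_of_mem_primesLE hp).two_le
    omega
  have hE : Real.exp (mG x) = ((∏ p ∈ Nat.primesLE x, p : ℕ) : ℝ) /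
      ((∏ p ∈ Nat.primesLE x, (p - 1) : ℕ) : ℝ) := by
    unfold mG
    rw [Real.exp_sum, Nat.cast_prod, Nat.cast_prod, ← Finset.prod_div_distrib]
    refine Finset.prod_congr rfl ?_
    intro p hp
    have h2 := (Nat.prime_of_mem_primesLE hp).two_le
    have h3 : (2 : ℝ) ≤ p := by exact_mod_cast h2
    rw [Real.exp_log (div_pos (by linarith) (by linarith)), Nat.cast_sub (by omega), Nat.cast_one]
  rw [hE, div_le_iff₀ hpos]
  exact h

lemma primesLE_pow (k : ℕ) :
    Nat.primesLE (2 ^ k - 1) = (Ico 0 (0 + 2 ^ k)).filter Nat.Prime := by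
  rw [Nat.primesLE_eq_filter_range, Nat.sub_add_cancel Nat.one_le_two_pow]
  simp

lemma mG_le_pow (k : ℕ) (hk : k ≤ 14) (c : ℕ) (h : numT k 0 * 1000 ≤ c * denT k 0) (q : ℕ)
    (hq : q < 2 ^ k) : Real.exp (mG q) ≤ (c : ℝ) / 1000 := by
  have hk2 : 0 + 2 ^ k ≤ 16384 := by
    have := Nat.pow_le_pow_right (show 0 < 2 by norm_num) hk
    norm_num at this ⊢
    exact this
  rw [numT_eq k 0 hk2, denT_eq k 0 hk2, ← primesLE_pow] at h
  refine le_trans (Real.exp_le_exp.2 (mG_mono (show q ≤ 2 ^ k - 1 by omega))) ?_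
  apply mG_le
  have h' : ((∏ p ∈ Nat.primesLE (2 ^ k - 1), p : ℕ) : ℝ) * 1000 ≤
    c * ((∏ p ∈ Nat.primesLE (2 ^ k - 1), (p - 1) : ℕ) : ℝ) := by exact_mod_cast h
  linarith

lemma mTh_ge_pow (k : ℕ) (hk : k ≤ 14) (a : ℕ) (h : 2 ^ a ≤ numT k 0) (q : ℕ)
    (hq : 2 ^ k - 1 ≤ q) : (a : ℝ) * Real.log 2 ≤ mTh q := by
  have hk2 : 0 + 2 ^ k ≤ 16384 := by
    have := Nat.pow_le_pow_right (show 0 < 2 by norm_num) hk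
    norm_num at this ⊢
    exact this
  rw [numT_eq k 0 hk2, ← primesLE_pow] at h
  refine le_trans ?_ (mTh_mono hq)
  rw [mTh_eq, ← Real.log_pow]
  exact Real.log_le_log (by positivity) (by exact_mod_cast h)

lemma block (q : ℕ) (a : ℕ) (c t : ℝ) (u v : ℕ) (hv : 0 < v) (ht : 0 < t) (hta : t ≤ 0.693 * a)
    (h1 : (a : ℝ) * Real.log 2 ≤ mTh q)
    (h2 : Real.exp (mG q) ≤ c) (h3 : (2.7182818286 : ℝ) ^ u ≤ t ^ v)
    (h4 : c < 7 / 3 * ((u : ℝ) / v)) :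
    Real.exp (mG q) < 7 / 3 * Real.log (mTh q) := by
  have h5 := log_lb t ht u v hv h3
  have h6 : Real.log t ≤ Real.log (mTh q) := by
    apply Real.log_le_log ht
    have := Real.log_two_gt_d9
    have ha : (0 : ℝ) ≤ a := by positivity
    nlinarith
  linarith

lemma blocks_big (q : ℕ) (h1 : 63 ≤ q) (h2 : q < 16384) :
    Real.exp (mG q) < 7 / 3 * Real.log (mTh q) := by
  obtain ⟨d7, d8, d9, d10, d11, d12, d13, d14⟩ := comp_den
  obtain ⟨n6, n7, n8, n9, n10, n11, n12, n13⟩ := comp_num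
  rcases lt_or_ge q 128 with h | h'
  · have h0 := h1
    exact block q 76 _ 52 39 10 (by norm_num) (by norm_num) (by norm_num)
      (mTh_ge_pow 6 (by norm_num) _ n6 q (le_trans (by norm_num) h0))
      (mG_le_pow 7 (by norm_num) _ d7 q (lt_of_lt_of_le h (by norm_num))) (by norm_num) (by norm_num)
  have h0 := h'; clear h'
  rcases lt_or_ge q 256 with h | h'
  · exact block q 161 _ 111 47 10 (by norm_num) (by norm_num) (by norm_num)
      (mTh_ge_pow 7 (by norm_num) _ n7 q (le_trans (by norm_num) h0))
      (mG_le_pow 8 (by norm_num) _ d8 q (lt_of_lt_of_le h (by norm_num))) (by norm_num) (by norm_num)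
  have h0 := h'; clear h'
  rcases lt_or_ge q 512 with h | h'
  · exact block q 334 _ 230 54 10 (by norm_num) (by norm_num) (by norm_num)
      (mTh_ge_pow 8 (by norm_num) _ n8 q (le_trans (by norm_num) h0))
      (mG_le_pow 9 (by norm_num) _ d9 q (lt_of_lt_of_le h (by norm_num))) (by norm_num) (by norm_num)
  have h0 := h'; clear h'
  rcases lt_or_ge q 1024 with h | h'
  · exact block q 702 _ 480 61 10 (by norm_num) (by norm_num) (by norm_num)
      (mTh_ge_pow 9 (by norm_num) _ n9 q (le_trans (by norm_num) h0))
      (mG_le_pow 10 (by norm_num) _ d10 q (lt_of_lt_of_le h (by norm_num))) (by norm_num) (by norm_num)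
  have h0 := h'; clear h'
  rcases lt_or_ge q 2048 with h | h'
  · exact block q 1410 _ 970 68 10 (by norm_num) (by norm_num) (by norm_num)
      (mTh_ge_pow 10 (by norm_num) _ n10 q (le_trans (by norm_num) h0))
      (mG_le_pow 11 (by norm_num) _ d11 q (lt_of_lt_of_le h (by norm_num))) (by norm_num) (by norm_num)
  have h0 := h'; clear h'
  rcases lt_or_ge q 4096 with h | h'
  · exact block q 2860 _ 1900 75 10 (by norm_num) (by norm_num) (by norm_num)
      (mTh_ge_pow 11 (by norm_num) _ n11 q (le_trans (by norm_num) h0))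
      (mG_le_pow 12 (by norm_num) _ d12 q (lt_of_lt_of_le h (by norm_num))) (by norm_num) (by norm_num)
  have h0 := h'; clear h'
  rcases lt_or_ge q 8192 with h | h'
  · exact block q 5800 _ 4000 82 10 (by norm_num) (by norm_num) (by norm_num)
      (mTh_ge_pow 12 (by norm_num) _ n12 q (le_trans (by norm_num) h0))
      (mG_le_pow 13 (by norm_num) _ d13 q (lt_of_lt_of_le h (by norm_num))) (by norm_num) (by norm_num)
  · have h := h2
    have h0 := h'
    exact block q 11600 _ 8000 89 10 (by norm_num) (by norm_num) (by norm_num)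
      (mTh_ge_pow 13 (by norm_num) _ n13 q (le_trans (by norm_num) h0))
      (mG_le_pow 14 (by norm_num) _ d14 q (lt_of_lt_of_le h (by norm_num))) (by norm_num) (by norm_num)

lemma primesLE_small (x : ℕ) (hx : x < 16384) :
    Nat.primesLE x = (Finset.range (x + 1)).filter (fun i => isP i = true) := by
  rw [Nat.primesLE_eq_filter_range]
  refine Finset.filter_congr ?_
  intro i hi
  rw [isP_iff i (by rw [Finset.mem_range] at hi; omega)]

lemma mG_le_small (x q c : ℕ) (hx : x < 16384) (hq : q ≤ x)
    (h : 1000 * ∏ p ∈ (Finset.range (x + 1)).filter (fun i => isP i = true), p ≤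
      c * ∏ p ∈ (Finset.range (x + 1)).filter (fun i => isP i = true), (p - 1)) :
    Real.exp (mG q) ≤ (c : ℝ) / 1000 := by
  refine le_trans (Real.exp_le_exp.2 (mG_mono hq)) ?_
  apply mG_le
  rw [← primesLE_small x hx] at h
  have h' : 1000 * ((∏ p ∈ Nat.primesLE x, p : ℕ) : ℝ) ≤
    c * ((∏ p ∈ Nat.primesLE x, (p - 1) : ℕ) : ℝ) := by exact_mod_cast h
  linarith

lemma mTh_ge_small (x q a : ℕ) (hx : x < 16384) (hq : x ≤ q)
    (h : 2 ^ a ≤ ∏ p ∈ (Finset.range (x + 1)).filter (fun i => isP i = true), p) :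
    (a : ℝ) * Real.log 2 ≤ mTh q := by
  refine le_trans ?_ (mTh_mono hq)
  rw [← primesLE_small x hx] at h
  rw [mTh_eq, ← Real.log_pow]
  exact Real.log_le_log (by positivity) (by exact_mod_cast h)

lemma blocks_small (q : ℕ) (h1 : 13 ≤ q) (h2 : q < 64) :
    Real.exp (mG q) < 7 / 3 * Real.log (mTh q) := by
  rcases lt_or_ge q 17 with h | h
  · exact block q 14 _ 9.7 227 100 (by norm_num) (by norm_num) (by norm_num)
      (mTh_ge_small 13 q _ (by norm_num) h1 (by decide +kernel))
      (mG_le_small 16 q 5214 (by norm_num) (by omega) (by decide +kernel)) (by norm_num)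
      (by norm_num)
  rcases lt_or_ge q 23 with h | h
  · exact block q 18 _ 12.47 252 100 (by norm_num) (by norm_num) (by norm_num)
      (mTh_ge_small 17 q _ (by norm_num) (by omega) (by decide +kernel))
      (mG_le_small 22 q 5848 (by norm_num) (by omega) (by decide +kernel)) (by norm_num)
      (by norm_num)
  rcases lt_or_ge q 37 with h | h
  · exact block q 27 _ 18.7 29 10 (by norm_num) (by norm_num) (by norm_num)
      (mTh_ge_small 23 q _ (by norm_num) (by omega) (by decide +kernel))
      (mG_le_small 36 q 6543 (by norm_num) (by omega) (by decide +kernel)) (by norm_num)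
      (by norm_num)
  · exact block q 42 _ 29 33 10 (by norm_num) (by norm_num) (by norm_num)
      (mTh_ge_small 37 q _ (by norm_num) (by omega) (by decide +kernel))
      (mG_le_small 63 q 7600 (by norm_num) (by omega) (by decide +kernel)) (by norm_num)
      (by norm_num)

/-! ### Mertens' first theorem, explicit upper bound -/

open ArithmeticFunction in
/-- the sum `∑ Λ(d)/d` -/
noncomputable def mA (x : ℕ) : ℝ := ∑ d ∈ Ioc 0 x, vonMangoldt d / d

open ArithmeticFunction in
lemma log_factorial_eq (x : ℕ) :
    Real.log (x.factorial : ℝ) = ∑ d ∈ Ioc 0 x, vonMangoldt d * ((x / d : ℕ) : ℝ) := by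
  induction x with
  | zero => simp
  | succ x ih =>
    have h1 : ∑ d ∈ Ioc 0 (x + 1), vonMangoldt d * (((x + 1) / d : ℕ) : ℝ) =
        ∑ d ∈ Ioc 0 (x + 1), vonMangoldt d * ((x / d : ℕ) : ℝ) +
        ∑ d ∈ Ioc 0 (x + 1), (if d ∣ x + 1 then vonMangoldt d else 0) := by
      rw [← Finset.sum_add_distrib]
      refine Finset.sum_congr rfl ?_
      intro d _
      rw [Nat.succ_div]
      split_ifs <;> push_cast <;> ring
    have h2 : ∑ d ∈ Ioc 0 (x + 1), (if d ∣ x + 1 then vonMangoldt d else 0) =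
        Real.log ((x + 1 : ℕ) : ℝ) := by
      rw [← vonMangoldt_sum, ← Finset.sum_filter]
      refine Finset.sum_congr ?_ (fun _ _ => rfl)
      ext d
      simp only [Finset.mem_filter, Finset.mem_Ioc, Nat.mem_divisors]
      constructor
      · rintro ⟨_, h⟩; exact ⟨h, by omega⟩
      · rintro ⟨h, _⟩
        exact ⟨⟨Nat.pos_of_dvd_of_pos h (by omega), Nat.le_of_dvd (by omega) h⟩, h⟩
    rw [h1, h2, Finset.sum_Ioc_succ_top (by omega), ← ih,
      Nat.div_eq_of_lt (show x < x + 1 by omega), Nat.factorial_succ, Nat.cast_mul,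
      Real.log_mul (by positivity) (by positivity)]
    simp
    ring

lemma log_succ_sub (x : ℕ) (hx : 0 < x) :
    1 / ((x : ℝ) + 1) ≤ Real.log ((x + 1 : ℕ) : ℝ) - Real.log (x : ℝ) ∧
    Real.log ((x + 1 : ℕ) : ℝ) - Real.log (x : ℝ) ≤ 1 / (x : ℝ) := by
  have hx' : (0 : ℝ) < x := by exact_mod_cast hx
  push_cast
  rw [← Real.log_div (by positivity) (by positivity)]
  constructor
  · have := Real.one_sub_inv_le_log_of_pos (show 0 < ((x : ℝ) + 1) / x by positivity)
    refine le_trans (le_of_eq ?_) this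
    field_simp
    ring
  · have := Real.log_le_sub_one_of_pos (show 0 < ((x : ℝ) + 1) / x by positivity)
    refine le_trans this (le_of_eq ?_)
    field_simp
    ring

lemma log_factorial_le (x : ℕ) (hx : 1 ≤ x) :
    Real.log (x.factorial : ℝ) ≤ (x + 1) * Real.log x - x + 1 := by
  induction x, hx using Nat.le_induction with
  | base => simp
  | succ x hx ih =>
    rw [Nat.factorial_succ, Nat.cast_mul, Real.log_mul (by positivity) (by positivity)]
    have h := (log_succ_sub x hx).1
    rw [div_le_iff₀ (by positivity)] at h
    push_cast at h ⊢
    nlinarith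

lemma log_factorial_ge (x : ℕ) (hx : 1 ≤ x) :
    (x : ℝ) * Real.log x - x ≤ Real.log (x.factorial : ℝ) := by
  induction x, hx using Nat.le_induction with
  | base => simp
  | succ x hx ih =>
    rw [Nat.factorial_succ, Nat.cast_mul, Real.log_mul (by positivity) (by positivity)]
    have h := (log_succ_sub x hx).2
    have hx' : (0 : ℝ) < x := by exact_mod_cast hx
    rw [le_div_iff₀ (by positivity)] at h
    push_cast at h ⊢
    nlinarith

open ArithmeticFunction in
lemma mA_ge (x : ℕ) (hx : 1 ≤ x) : Real.log x - 1 ≤ mA x := by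
  have hx' : (0 : ℝ) < x := by exact_mod_cast hx
  have h1 : Real.log (x.factorial : ℝ) ≤ x * mA x := by
    rw [log_factorial_eq, mA, Finset.mul_sum]
    refine Finset.sum_le_sum ?_
    intro d _
    have h2 : ((x / d : ℕ) : ℝ) ≤ (x : ℝ) / d := Nat.cast_div_le
    calc vonMangoldt d * ((x / d : ℕ) : ℝ) ≤ vonMangoldt d * ((x : ℝ) / d) :=
          mul_le_mul_of_nonneg_left h2 vonMangoldt_nonneg
      _ = _ := by ring
  have h3 := log_factorial_ge x hx
  have h4 : (x : ℝ) * (Real.log x - 1) ≤ x * mA x := by linarith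
  exact le_of_mul_le_mul_left h4 hx'

open ArithmeticFunction in
lemma mA_le (x : ℕ) (hx : 1 ≤ x) : x * mA x ≤
    (x + 1) * Real.log x - x + 1 + (Real.log 4 * x + 2 * √(x : ℝ) * Real.log x) := by
  have hx' : (1 : ℝ) ≤ x := by exact_mod_cast hx
  have h1 : x * mA x ≤ Real.log (x.factorial : ℝ) + Chebyshev.psi x := by
    rw [log_factorial_eq, mA, Finset.mul_sum, Chebyshev.psi, Nat.floor_natCast,
      ← Finset.sum_add_distrib]
    refine Finset.sum_le_sum ?_
    intro d hd
    have h2 : (x : ℝ) / d ≤ ((x / d : ℕ) : ℝ) + 1 := by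
      have hd0 : 0 < d := (Finset.mem_Ioc.1 hd).1
      rw [div_le_iff₀ (by exact_mod_cast hd0)]
      have := Nat.lt_div_mul_add (a := x) hd0
      have h3 : (x : ℝ) ≤ ((x / d * d + d : ℕ) : ℝ) := by exact_mod_cast this.le
      push_cast at h3
      linarith
    calc x * (vonMangoldt d / d) = vonMangoldt d * ((x : ℝ) / d) := by ring
      _ ≤ vonMangoldt d * (((x / d : ℕ) : ℝ) + 1) :=
          mul_le_mul_of_nonneg_left h2 vonMangoldt_nonneg
      _ = _ := by ring
  have h3 := log_factorial_le x hx
  have h4 := Chebyshev.psi_le hx'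
  linarith

lemma log_16384 : Real.log 16384 = 14 * Real.log 2 := by
  rw [show (16384 : ℝ) = 2 ^ 14 by norm_num, Real.log_pow]; norm_num

lemma log_le_sqrt (x : ℕ) (hx : 16384 ≤ x) : 128 * Real.log x ≤ 9.71 * √(x : ℝ) := by
  have hx' : (16384 : ℝ) ≤ x := by exact_mod_cast hx
  have h0 : Real.exp 2 ≤ 16384 := by
    have : Real.exp 2 = Real.exp 1 ^ 2 := by rw [← Real.exp_nat_mul]; simp
    rw [this]
    have := Real.exp_one_lt_d9
    have := Real.exp_pos 1
    nlinarith
  have h := Real.log_div_sqrt_antitoneOn (show (16384 : ℝ) ∈ Set.Ici (Real.exp 2) from h0)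
    (show (x : ℝ) ∈ Set.Ici (Real.exp 2) from le_trans h0 hx') hx'
  simp only at h
  have h2 : √(16384 : ℝ) = 128 := by
    rw [show (16384 : ℝ) = 128 ^ 2 by norm_num]; exact Real.sqrt_sq (by norm_num)
  have hs : 0 < √(x : ℝ) := Real.sqrt_pos.2 (by linarith)
  rw [h2, log_16384, div_le_div_iff₀ hs (by norm_num)] at h
  have := Real.log_two_lt_d9
  nlinarith

lemma sqrt_facts (x : ℕ) (hx : 16384 ≤ x) : 128 ≤ √(x : ℝ) ∧ √(x : ℝ) * √(x : ℝ) = x := by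
  have hx' : (16384 : ℝ) ≤ x := by exact_mod_cast hx
  refine ⟨Real.le_sqrt_of_sq_le (by norm_num; linarith), Real.mul_self_sqrt (by linarith)⟩

lemma mA_le_big (x : ℕ) (hx : 16384 ≤ x) : mA x ≤ Real.log x + 0.6 := by
  have hx' : (16384 : ℝ) ≤ x := by exact_mod_cast hx
  have h := mA_le x (by omega)
  have h1 := log_le_sqrt x hx
  obtain ⟨h2, h3⟩ := sqrt_facts x hx
  have h4 : Real.log 4 = 2 * Real.log 2 := by
    rw [show (4 : ℝ) = 2 ^ 2 by norm_num, Real.log_pow]; norm_num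
  have h5 := Real.log_two_lt_d9
  have h6 : √(x : ℝ) * (128 * Real.log x) ≤ 9.71 * x := by nlinarith
  have h7 : 128 * Real.log x ≤ 9.71 * (x / 128) := by nlinarith
  refine le_of_mul_le_mul_left (a := (x : ℝ)) ?_ (by linarith)
  rw [h4] at h
  nlinarith

lemma mTh_ge_big (x : ℕ) (hx : 16384 ≤ x) : (x : ℝ) / 2 ≤ mTh x := by
  have hx' : (16384 : ℝ) ≤ x := by exact_mod_cast hx
  have h := Chebyshev.theta_ge x
  rw [Chebyshev.theta_eq_sum_primesLE_log] at h
  change _ ≤ mTh x at h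
  have h1 := log_le_sqrt x hx
  obtain ⟨h2, h3⟩ := sqrt_facts x hx
  have h5 := Real.log_two_gt_d9
  have h6 : √(x : ℝ) * (128 * Real.log x) ≤ 9.71 * x := by nlinarith
  have h7 : 128 * Real.log x ≤ 9.71 * (x / 128) := by nlinarith
  have h8 := (log_succ_sub x (by omega)).2
  push_cast at h8
  have h9 : 1 / (x : ℝ) ≤ 1 := by rw [div_le_one (by linarith)]; linarith
  nlinarith

/-! ### Abel summation -/

open ArithmeticFunction in
/-- `∑ log p / p` -/
noncomputable def mB (x : ℕ) : ℝ := ∑ p ∈ Nat.primesLE x, Real.log (p : ℝ) / p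

lemma mB_succ (x : ℕ) :
    mB (x + 1) = mB x + if (x + 1).Prime then Real.log ((x + 1 : ℕ) : ℝ) / (x + 1 : ℕ) else 0 := by
  unfold mB
  rw [Nat.primesLE_succ]
  split_ifs with h
  · rw [Finset.sum_insert (Nat.notMem_primesLE x)]; ring
  · simp

lemma mG_succ (x : ℕ) :
    mG (x + 1) = mG x + if (x + 1).Prime then
      Real.log (((x + 1 : ℕ) : ℝ) / ((x + 1 : ℕ) - 1)) else 0 := by
  unfold mG
  rw [Nat.primesLE_succ]
  split_ifs with h
  · rw [Finset.sum_insert (Nat.notMem_primesLE x)]; ring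
  · simp

open ArithmeticFunction in
lemma mB_sub_le (x y : ℕ) (h : x ≤ y) : mB y - mB x ≤ mA y - mA x := by
  induction y, h using Nat.le_induction with
  | base => simp
  | succ y hy ih =>
    rw [mB_succ]
    have h1 : mA (y + 1) = mA y + vonMangoldt (y + 1) / ((y + 1 : ℕ) : ℝ) := by
      unfold mA
      rw [Finset.sum_Ioc_succ_top (by omega)]
    rw [h1]
    split_ifs with hp
    · rw [vonMangoldt_apply_prime hp]; linarith
    · have : 0 ≤ vonMangoldt (y + 1) / ((y + 1 : ℕ) : ℝ) :=
        div_nonneg vonMangoldt_nonneg (by positivity)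
      linarith

/-- The slack in the first Mertens estimate. -/
noncomputable def mS (x : ℕ) : ℝ := 1.6 + Real.log x - Real.log 16384 - (mB x - mB 16384)

lemma mS_nonneg (x : ℕ) (hx : 16384 ≤ x) : 0 ≤ mS x := by
  have h1 := mB_sub_le 16384 x hx
  have h2 := mA_le_big x hx
  have h3 := mA_ge 16384 (by norm_num)
  unfold mS
  push_cast at h3
  linarith

lemma abel (x : ℕ) (hx : 16384 ≤ x) :
    mG x + 1 / (x : ℝ) + mS x / Real.log x ≤
      mG 16384 + 1 / 16384 + 1.6 / Real.log 16384 +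
        Real.log (Real.log x) - Real.log (Real.log 16384) := by
  induction x, hx using Nat.le_induction with
  | base =>
    unfold mS
    push_cast
    simp
  | succ x hx ih =>
    have hx' : (16384 : ℝ) ≤ x := by exact_mod_cast hx
    have hL : 0 < Real.log x := Real.log_pos (by linarith)
    have hLL : Real.log x ≤ Real.log ((x + 1 : ℕ) : ℝ) :=
      Real.log_le_log (by linarith) (by push_cast; linarith)
    have hL' : 0 < Real.log ((x + 1 : ℕ) : ℝ) := lt_of_lt_of_le hL hLL
    have hS := mS_nonneg x hx
    set a : ℝ := if (x + 1).Prime then Real.log ((x + 1 : ℕ) : ℝ) / (x + 1 : ℕ) else 0 with ha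
    have hS1 : mS (x + 1) = mS x + (Real.log ((x + 1 : ℕ) : ℝ) - Real.log x) - a := by
      unfold mS
      rw [mB_succ]
      ring
    have hG1 : mG (x + 1) + 1 / ((x + 1 : ℕ) : ℝ) ≤
        mG x + 1 / (x : ℝ) + a / Real.log ((x + 1 : ℕ) : ℝ) := by
      rw [mG_succ, ha]
      split_ifs with hp
      · have h1 := Real.log_le_sub_one_of_pos (show 0 < ((x + 1 : ℕ) : ℝ) / ((x + 1 : ℕ) - 1) by
          push_cast
          rw [add_sub_cancel_right]
          positivity)
        have h2 : ((x + 1 : ℕ) : ℝ) / ((x + 1 : ℕ) - 1) - 1 = 1 / x := by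
          push_cast
          rw [add_sub_cancel_right]
          field_simp
          ring
        have h3 : Real.log ((x + 1 : ℕ) : ℝ) / (x + 1 : ℕ) / Real.log ((x + 1 : ℕ) : ℝ) =
            1 / ((x + 1 : ℕ) : ℝ) := by
          field_simp
        rw [h3]
        rw [h2] at h1
        linarith
      · have : 1 / ((x + 1 : ℕ) : ℝ) ≤ 1 / (x : ℝ) := by
          apply one_div_le_one_div_of_le (by linarith)
          push_cast; linarith
        simp only [zero_div, add_zero]
        linarith
    have h4 : mS x / Real.log ((x + 1 : ℕ) : ℝ) ≤ mS x / Real.log x :=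
      div_le_div_of_nonneg_left hS hL hLL
    have h5 : (Real.log ((x + 1 : ℕ) : ℝ) - Real.log x) / Real.log ((x + 1 : ℕ) : ℝ) ≤
        Real.log (Real.log ((x + 1 : ℕ) : ℝ)) - Real.log (Real.log x) := by
      rw [← Real.log_div hL'.ne' hL.ne']
      have := Real.one_sub_inv_le_log_of_pos (div_pos hL' hL)
      rw [inv_div] at this
      refine le_trans (le_of_eq ?_) this
      field_simp
    have h6 : mS (x + 1) / Real.log ((x + 1 : ℕ) : ℝ) =
        mS x / Real.log ((x + 1 : ℕ) : ℝ) +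
        (Real.log ((x + 1 : ℕ) : ℝ) - Real.log x) / Real.log ((x + 1 : ℕ) : ℝ) -
        a / Real.log ((x + 1 : ℕ) : ℝ) := by
      rw [hS1]; ring
    linarith

lemma big_case (q : ℕ) (hq : 16384 ≤ q) : Real.exp (mG q) < 7 / 3 * Real.log (mTh q) := by
  have hq' : (16384 : ℝ) ≤ q := by exact_mod_cast hq
  have l1 := Real.log_two_gt_d9
  have l2 := Real.log_two_lt_d9
  have hX : 9.7 ≤ Real.log 16384 := by rw [log_16384]; linarith
  have hL : Real.log 16384 ≤ Real.log q := Real.log_le_log (by norm_num) hq'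
  have h1 := abel q hq
  have h2 : 0 ≤ mS q / Real.log q := div_nonneg (mS_nonneg q hq) (by linarith)
  have h3 : 0 ≤ 1 / (q : ℝ) := by positivity
  have hG : Real.exp (mG 16384) ≤ 17.3 := by
    have := mG_le_pow 14 (by norm_num) 17300 comp_den.2.2.2.2.2.2.2 16383 (by norm_num)
    have h2 := mG_succ 16383
    rw [if_neg (by norm_num)] at h2
    rw [h2, add_zero]
    refine le_trans this ?_
    norm_num
  have h4 : 1.6 / Real.log 16384 ≤ 0.165 := by
    rw [div_le_iff₀ (by linarith)]; linarith
  have h5 : mG q ≤ mG 16384 + 1 / 6 + Real.log (Real.log q) - Real.log (Real.log 16384) := by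
    have : (1 : ℝ) / 16384 + 0.165 ≤ 1 / 6 := by norm_num
    linarith
  have h6 : Real.exp (mG q) ≤ Real.exp (mG 16384) * Real.exp (1 / 6) * Real.log q /
      Real.log 16384 := by
    refine le_trans (Real.exp_le_exp.2 h5) (le_of_eq ?_)
    rw [Real.exp_sub, Real.exp_add, Real.exp_add, Real.exp_log (by linarith),
      Real.exp_log (by linarith)]
  have h7 : Real.exp (1 / 6) ≤ 1.19 := by
    rw [← Real.le_log_iff_exp_le (by norm_num)]
    have := log_lb 1.19 (by norm_num) 1 6 (by norm_num) (by norm_num)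
    norm_num at this ⊢
    linarith
  have h8 : Real.exp (mG q) ≤ 2.13 * Real.log q := by
    refine le_trans h6 ?_
    rw [div_le_iff₀ (by linarith)]
    have h9 : Real.exp (mG 16384) * Real.exp (1 / 6) ≤ 17.3 * 1.19 :=
      mul_le_mul hG h7 (Real.exp_pos _).le (by norm_num)
    have h10 : Real.exp (mG 16384) * Real.exp (1 / 6) ≤ 2.13 * Real.log 16384 := by
      refine le_trans h9 ?_
      linarith
    nlinarith
  have h9 : Real.log q - Real.log 2 ≤ Real.log (mTh q) := by
    rw [← Real.log_div (by linarith) (by norm_num)]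
    exact Real.log_le_log (by linarith) (mTh_ge_big q hq)
  rw [log_16384] at hL
  linarith

lemma mertens_bound (q : ℕ) (hq : 13 ≤ q) : Real.exp (mG q) < 7 / 3 * Real.log (mTh q) := by
  rcases lt_or_ge q 64 with h | h
  · exact blocks_small q hq h
  rcases lt_or_ge q 16384 with h' | h'
  · exact blocks_big q (by omega) h'
  · exact big_case q h'

/-! ### Reduction to primorials -/

lemma sum_exchange (S T : Finset ℕ) (hc : S.card = T.card) (f : ℕ → ℝ) (c : ℝ)
    (h1 : ∀ s ∈ S, s ∉ T → c ≤ f s) (h2 : ∀ t ∈ T, t ∉ S → f t ≤ c) :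
    ∑ t ∈ T, f t ≤ ∑ s ∈ S, f s := by
  have hS := Finset.sum_sdiff (f := f) (Finset.inter_subset_left (s₁ := S) (s₂ := T))
  have hT := Finset.sum_sdiff (f := f) (Finset.inter_subset_right (s₁ := S) (s₂ := T))
  rw [Finset.sdiff_inter_self_left] at hS
  rw [Finset.sdiff_inter_self_right] at hT
  have hc' : (S \ T).card = (T \ S).card := Finset.card_sdiff_comm hc
  have h3 : (S \ T).card • c ≤ ∑ s ∈ S \ T, f s := by
    apply Finset.card_nsmul_le_sum
    intro s hs
    rw [Finset.mem_sdiff] at hs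
    exact h1 s hs.1 hs.2
  have h4 : ∑ t ∈ T \ S, f t ≤ (T \ S).card • c := by
    apply Finset.sum_le_card_nsmul
    intro s hs
    rw [Finset.mem_sdiff] at hs
    exact h2 s hs.1 hs.2
  rw [hc'] at h3
  linarith

lemma primorial_reduction (S : Finset ℕ) (hS : ∀ p ∈ S, p.Prime) (hne : S.Nonempty) :
    ∃ q : ℕ, q.Prime ∧ mTh q ≤ ∑ p ∈ S, Real.log (p : ℝ) ∧
      ∑ p ∈ S, Real.log ((p : ℝ) / (p - 1)) ≤ mG q := by
  set q := Nat.nth Nat.Prime (S.card - 1) with hq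
  have hqp : q.Prime := Nat.prime_nth_prime _
  have hpos : 0 < S.card := Finset.card_pos.2 hne
  have hcard : (Nat.primesLE q).card = S.card := by
    rw [Nat.primesLE_card_eq_primeCounting, Nat.primeCounting_eq_primeCounting'_succ,
      Nat.primeCounting', Nat.count_succ, if_pos hqp]
    have := Nat.primeCounting'_nth_eq (S.card - 1)
    rw [Nat.primeCounting'] at this
    rw [hq, this]
    omega
  have hgt : ∀ s ∈ S, s ∉ Nat.primesLE q → q < s := by
    intro s hs hn
    rw [Nat.mem_primesLE] at hn
    by_contra h
    exact hn ⟨by omega, hS s hs⟩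
  have hq2 : (2 : ℝ) ≤ q := by exact_mod_cast hqp.two_le
  refine ⟨q, hqp, ?_, ?_⟩
  · unfold mTh
    refine sum_exchange S _ hcard.symm (fun p => Real.log (p : ℝ)) (Real.log q) ?_ ?_
    · intro s hs hn
      have : (q : ℝ) ≤ s := by exact_mod_cast (hgt s hs hn).le
      exact Real.log_le_log (by linarith) this
    · intro t ht _
      rw [Nat.mem_primesLE] at ht
      have : (t : ℝ) ≤ q := by exact_mod_cast ht.1
      exact Real.log_le_log (by exact_mod_cast ht.2.pos) this
  · unfold mG
    have key : ∀ a b : ℝ, 2 ≤ a → a ≤ b → Real.log (b / (b - 1)) ≤ Real.log (a / (a - 1)) := by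
      intro a b ha hab
      apply Real.log_le_log (div_pos (by linarith) (by linarith))
      rw [div_le_div_iff₀ (by linarith) (by linarith)]
      nlinarith
    refine sum_exchange _ S hcard (fun p => Real.log ((p : ℝ) / (p - 1)))
      (Real.log ((q : ℝ) / (q - 1))) ?_ ?_
    · intro t ht _
      rw [Nat.mem_primesLE] at ht
      exact key _ _ (by exact_mod_cast ht.2.two_le) (by exact_mod_cast ht.1)
    · intro s hs hn
      exact key _ _ hq2 (by exact_mod_cast (hgt s hs hn).le)

lemma sigma_totient_le (n : ℕ) : ArithmeticFunction.sigma 1 n * Nat.totient n ≤ n ^ 2 := by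
  induction n using Nat.recOnPosPrimePosCoprime with
  | prime_pow p k hp hk =>
    rw [ArithmeticFunction.sigma_one_apply_prime_pow hp, Nat.totient_prime_pow hp hk]
    have h := Nat.geomSum_eq hp.two_le (k + 1)
    have h2 : (∑ i ∈ Finset.range (k + 1), p ^ i) * (p - 1) ≤ p ^ (k + 1) := by
      rw [h]
      exact le_trans (Nat.div_mul_le_self _ _) (Nat.sub_le _ _)
    calc _ = (∑ i ∈ Finset.range (k + 1), p ^ i) * (p - 1) * p ^ (k - 1) := by ring
      _ ≤ p ^ (k + 1) * p ^ (k - 1) := Nat.mul_le_mul_right _ h2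
      _ = (p ^ k) ^ 2 := by
        rw [← pow_add, ← pow_mul]
        congr 1
        omega
  | zero => simp
  | one => simp
  | coprime a b ha hb hab iha ihb =>
    rw [ArithmeticFunction.isMultiplicative_sigma.map_mul_of_coprime hab, Nat.totient_mul hab]
    calc _ = (ArithmeticFunction.sigma 1 a * a.totient) * (ArithmeticFunction.sigma 1 b * b.totient)
          := by ring
      _ ≤ a ^ 2 * b ^ 2 := Nat.mul_le_mul iha ihb
      _ = _ := by ring

lemma sigma_le_prod (n : ℕ) (hn : 0 < n) (hodd : Odd n) :
    2 * (ArithmeticFunction.sigma 1 n : ℝ) ≤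
      n * Real.exp (∑ p ∈ (2 * n).primeFactors, Real.log ((p : ℝ) / (p - 1))) := by
  have hcop : Nat.Coprime 2 n := Nat.coprime_two_left.2 hodd
  have h1 := sigma_totient_le n
  have h2 : (Nat.totient (2 * n) : ℝ) = n.totient := by
    rw [Nat.totient_mul hcop]; simp
  have h3 : ((2 * n).totient : ℝ) = ((2 * n : ℕ) : ℝ) *
      ∏ p ∈ (2 * n).primeFactors, (1 - (p : ℝ)⁻¹) := by
    have := Nat.totient_eq_mul_prod_factors (2 * n)
    have h : (((2 * n).totient : ℚ) : ℝ) = ((((2 * n : ℕ) : ℚ) *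
      ∏ p ∈ (2 * n).primeFactors, (1 - (p : ℚ)⁻¹) : ℚ) : ℝ) := by rw [this]
    push_cast at h ⊢
    exact h
  have h4 : Real.exp (∑ p ∈ (2 * n).primeFactors, Real.log ((p : ℝ) / (p - 1))) *
      ∏ p ∈ (2 * n).primeFactors, (1 - (p : ℝ)⁻¹) = 1 := by
    rw [Real.exp_sum, ← Finset.prod_mul_distrib]
    apply Finset.prod_eq_one
    intro p hp
    have hp2 : (2 : ℝ) ≤ p := by exact_mod_cast (Nat.prime_of_mem_primeFactors hp).two_le
    have : (p : ℝ) - 1 ≠ 0 := by linarith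
    rw [Real.exp_log (div_pos (by linarith) (by linarith))]
    field_simp
  set E := Real.exp (∑ p ∈ (2 * n).primeFactors, Real.log ((p : ℝ) / (p - 1)))
  set D := ∏ p ∈ (2 * n).primeFactors, (1 - (p : ℝ)⁻¹)
  have hE : 0 < E := Real.exp_pos _
  have hn' : (0 : ℝ) < n := by exact_mod_cast hn
  have h5 : (ArithmeticFunction.sigma 1 n : ℝ) * n.totient ≤ (n : ℝ) ^ 2 := by exact_mod_cast h1
  rw [h2] at h3
  rw [h3] at h5
  push_cast at h5
  have h6 : ((ArithmeticFunction.sigma 1 n : ℝ) * (2 * n * D)) * E ≤ (n : ℝ) ^ 2 * E :=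
    mul_le_mul_of_nonneg_right h5 hE.le
  have h7 : ((ArithmeticFunction.sigma 1 n : ℝ) * (2 * n * D)) * E =
      n * (2 * (ArithmeticFunction.sigma 1 n : ℝ)) := by
    linear_combination (ArithmeticFunction.sigma 1 n : ℝ) * 2 * n * h4
  rw [h7] at h6
  refine le_of_mul_le_mul_left (a := (n : ℝ)) ?_ hn'
  linarith

/-! ### Small `n` -/

/-- sum of the odd divisors at most `2 k - 1`, for kernel evaluation -/
def sigR (n : ℕ) : ℕ → ℕ
  | 0 => 0
  | k + 1 => sigR n k + cond (Nat.beq (n % (2 * k + 1)) 0) (2 * k + 1) 0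

lemma sigR_eq (n k : ℕ) :
    sigR n k = ∑ i ∈ Finset.range k, if (2 * i + 1) ∣ n then 2 * i + 1 else 0 := by
  induction k with
  | zero => rfl
  | succ k ih =>
    rw [Finset.sum_range_succ, ← ih, sigR]
    congr 1
    by_cases h : (2 * k + 1) ∣ n
    · have : Nat.beq (n % (2 * k + 1)) 0 = true := by
        rw [Nat.beq_eq]; exact Nat.mod_eq_zero_of_dvd h
      rw [this, cond_true, if_pos h]
    · have : Nat.beq (n % (2 * k + 1)) 0 = false := by
        rw [← Bool.not_eq_true, Nat.beq_eq]
        intro h2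
        exact h (Nat.dvd_of_mod_eq_zero h2)
      rw [this, cond_false, if_neg h]

/-- sum of divisors of an odd number -/
def sigC (n : ℕ) : ℕ := sigR n (n / 2 + 1)

lemma sigC_eq (n : ℕ) (hn : n % 2 = 1) : ArithmeticFunction.sigma 1 n = sigC n := by
  rw [ArithmeticFunction.sigma_one_apply, sigC, sigR_eq, ← Finset.sum_filter]
  symm
  refine Finset.sum_bij (fun i _ => 2 * i + 1) ?_ ?_ ?_ ?_
  · intro i hi
    rw [Finset.mem_filter] at hi
    exact Nat.mem_divisors.2 ⟨hi.2, by omega⟩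
  · intro a _ b _ h
    omega
  · intro d hd
    rw [Nat.mem_divisors] at hd
    have hle := Nat.le_of_dvd (by omega) hd.1
    have hdo : d % 2 = 1 := Nat.odd_iff.1 ((Nat.odd_iff.2 hn).of_dvd_nat hd.1)
    refine ⟨d / 2, ?_, by omega⟩
    rw [Finset.mem_filter, Finset.mem_range, show 2 * (d / 2) + 1 = d by omega]
    exact ⟨by omega, hd.1⟩
  · intro i _
    rfl

/-- check `1000 σ(n) ≤ c n` for the odd `n = lo + 2 i`, `i < len` -/
def chk (c lo len : ℕ) : Bool :=
  (List.range len).all (fun i => Nat.ble (1000 * sigC (lo + 2 * i)) (c * (lo + 2 * i)))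

lemma chk_spec (c lo len n : ℕ) (h : chk c lo len = true) (hlo2 : lo % 2 = 1)
    (hn : n % 2 = 1) (h1 : lo ≤ n) (h2 : n < lo + 2 * len) :
    1000 * (ArithmeticFunction.sigma 1 n : ℝ) ≤ c * n := by
  rw [sigC_eq n hn]
  unfold chk at h
  rw [List.all_eq_true] at h
  have := h ((n - lo) / 2) (by rw [List.mem_range]; omega)
  rw [Nat.ble_eq, show lo + 2 * ((n - lo) / 2) = n by omega] at this
  exact_mod_cast this

lemma loglog_lb (N M : ℕ) (hNM : M ≤ N) (a b u v : ℕ) (hb : 0 < b) (hv : 0 < v) (ha : 0 < a)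
    (hM : 0 < M)
    (h1 : (2.7182818286 : ℝ) ^ a ≤ (M : ℝ) ^ b)
    (h2 : (2.7182818286 : ℝ) ^ u ≤ ((a : ℝ) / b) ^ v) :
    (u : ℝ) / v ≤ Real.log (Real.log (N : ℝ)) := by
  have hM' : (0 : ℝ) < M := by exact_mod_cast hM
  have h3 := log_lb M hM' a b hb h1
  have hab : 0 < (a : ℝ) / b := by positivity
  have h4 := log_lb _ hab u v hv h2
  refine le_trans h4 (Real.log_le_log hab (le_trans h3 ?_))
  exact Real.log_le_log hM' (by exact_mod_cast hNM)

lemma small_finish (n : ℕ) (hn : 0 < n) (c u v : ℕ)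
    (h : 1000 * (ArithmeticFunction.sigma 1 n : ℝ) ≤ c * n)
    (h2 : (u : ℝ) / v ≤ Real.log (Real.log ((2 * n : ℕ) : ℝ)))
    (h3 : (c : ℝ) < 1000 * (7 / 6 * ((u : ℝ) / v))) :
    (ArithmeticFunction.sigma 1 n : ℝ) < 7 / 6 * n * Real.log (Real.log ((2 * n : ℕ) : ℝ)) := by
  have hn' : (0 : ℝ) < n := by exact_mod_cast hn
  have h4 : (c : ℝ) < 1000 * (7 / 6 * Real.log (Real.log ((2 * n : ℕ) : ℝ))) := by linarith
  have := mul_lt_mul_of_pos_right h4 hn'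
  linarith

lemma small_n (n : ℕ) (hn : 17 ≤ n) (hn2 : n < 361) (hodd : Odd n) :
    (ArithmeticFunction.sigma 1 n : ℝ) < 7 / 6 * n * Real.log (Real.log ((2 * n : ℕ) : ℝ)) := by
  have ho : n % 2 = 1 := Nat.odd_iff.1 hodd
  rcases lt_or_ge n 21 with h | h
  · exact small_finish n (by omega) 1100 120 100
      (chk_spec 1100 17 2 n (by decide +kernel) (by norm_num) ho (by omega) (by omega))
      (loglog_lb _ 34 (by omega) 35 10 _ _ (by norm_num) (by norm_num) (by norm_num) (by norm_num)
        (by norm_num) (by norm_num)) (by norm_num)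
  rcases lt_or_ge n 45 with h' | h'
  · exact small_finish n (by omega) 1524 17 13
      (chk_spec 1524 21 12 n (by decide +kernel) (by norm_num) ho (by omega)
        (by omega))
      (loglog_lb _ 42 (by omega) 37 10 _ _ (by norm_num) (by norm_num) (by norm_num)
        (by norm_num) (by norm_num) (by norm_num)) (by norm_num)
  rcases lt_or_ge n 105 with h | h
  · exact small_finish n (by omega) 1734 58 39
      (chk_spec 1734 45 30 n (by decide +kernel) (by norm_num) ho (by omega)
        (by omega))
      (loglog_lb _ 90 (by omega) 49 11 _ _ (by norm_num) (by norm_num) (by norm_num)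
        (by norm_num) (by norm_num) (by norm_num)) (by norm_num)
  rcases lt_or_ge n 315 with h' | h'
  · exact small_finish n (by omega) 1829 16 10
      (chk_spec 1829 105 105 n (by decide +kernel) (by norm_num) ho (by omega)
        (by omega))
      (loglog_lb _ 210 (by omega) 53 10 _ _ (by norm_num) (by norm_num) (by norm_num)
        (by norm_num) (by norm_num) (by norm_num)) (by norm_num)
  · exact small_finish n (by omega) 2032 18 10
      (chk_spec 2032 315 23 n (by decide +kernel) (by norm_num) ho (by omega)
        (by omega))
      (loglog_lb _ 630 (by omega) 64 10 _ _ (by norm_num) (by norm_num) (by norm_num)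
        (by norm_num) (by norm_num) (by norm_num)) (by norm_num)

lemma large_n (n : ℕ) (hn : 360 ≤ n) (hodd : Odd n) :
    (ArithmeticFunction.sigma 1 n : ℝ) < 7 / 6 * n * Real.log (Real.log ((2 * n : ℕ) : ℝ)) := by
  have hn' : (0 : ℝ) < n := by exact_mod_cast (show 0 < n by omega)
  have h1 := sigma_le_prod n (by omega) hodd
  obtain ⟨q, hqp, hq1, hq2⟩ := primorial_reduction (2 * n).primeFactors
    (fun p hp => Nat.prime_of_mem_primeFactors hp)
    ⟨2, by rw [Nat.mem_primeFactors]; exact ⟨Nat.prime_two, ⟨n, rfl⟩, by omega⟩⟩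
  have h2 := Real.exp_le_exp.2 hq2
  have h3 : ∑ p ∈ (2 * n).primeFactors, Real.log (p : ℝ) ≤ Real.log ((2 * n : ℕ) : ℝ) := by
    rw [← Real.log_prod]
    · rw [← Nat.cast_prod]
      have hp : 0 < ∏ p ∈ (2 * n).primeFactors, p :=
        Finset.prod_pos (fun p hp => (Nat.prime_of_mem_primeFactors hp).pos)
      refine Real.log_le_log (by exact_mod_cast hp) ?_
      exact_mod_cast Nat.le_of_dvd (by omega) (Nat.prod_primeFactors_dvd (2 * n))
    · intro p hp
      exact_mod_cast (Nat.prime_of_mem_primeFactors hp).ne_zero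
  -- numbers between 1155 and 1320 are checked directly
  by_cases hmid : 1155 ≤ n ∧ n < 1321
  · exact small_finish n (by omega) 2032 18 10
      (chk_spec 2032 1155 83 n (by decide +kernel) (by norm_num) (Nat.odd_iff.1 hodd) (by omega)
        (by omega))
      (loglog_lb _ 630 (by omega) 64 10 _ _ (by norm_num) (by norm_num) (by norm_num)
        (by norm_num) (by norm_num) (by norm_num)) (by norm_num)
  have h4 : Real.exp (mG q) < 7 / 3 * Real.log (Real.log ((2 * n : ℕ) : ℝ)) := by
    rcases lt_or_ge q 11 with hq | hq
    · have h5 := mG_le_small 10 q 4375 (by norm_num) (by omega) (by decide +kernel)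
      have h6 := loglog_lb (2 * n) 720 (by omega) 46 7 32 17 (by norm_num) (by norm_num)
        (by norm_num) (by norm_num) (by norm_num) (by norm_num)
      norm_num at h5 h6 ⊢
      linarith
    have hbig : 1321 ≤ n := by
      have e1 : Real.log 2310 ≤ mTh q := by
        refine le_trans (le_of_eq ?_) (mTh_mono hq)
        rw [mTh_eq, primesLE_small 11 (by norm_num)]
        have : ∏ p ∈ (Finset.range (11 + 1)).filter (fun i => isP i = true), p = 2310 := by
          decide +kernel
        rw [this]
        norm_num
      have e2 : Real.log 2310 ≤ Real.log ((2 * n : ℕ) : ℝ) := by linarith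
      rw [Real.log_le_log_iff (by norm_num) (by push_cast; linarith)] at e2
      have e3 : 2310 ≤ 2 * n := by exact_mod_cast e2
      omega
    rcases lt_or_ge q 13 with hq | hq
    · have h5 := mG_le_small 12 q 4813 (by norm_num) (by omega) (by decide +kernel)
      have h6 := loglog_lb (2 * n) 2640 (by omega) 63 8 130 63 (by norm_num) (by norm_num)
        (by norm_num) (by norm_num) (by norm_num) (by norm_num)
      norm_num at h5 h6 ⊢
      linarith
    · have h5 := mertens_bound q hq
      have h6 : mTh 2 ≤ mTh q := mTh_mono (by omega)
      have h7 : 0 < mTh 2 := by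
        have := mTh_ge_small 2 2 1 (by norm_num) le_rfl (by decide +kernel)
        have := Real.log_two_gt_d9
        norm_num at *
        linarith
      have h8 : Real.log (mTh q) ≤ Real.log (Real.log ((2 * n : ℕ) : ℝ)) :=
        Real.log_le_log (by linarith) (by linarith)
      linarith
  have h5 := mul_le_mul_of_nonneg_left h2 hn'.le
  have h6 := mul_lt_mul_of_pos_left h4 hn'
  linarith

theorem odd_sigma_bound (n : ℕ) (hn : 17 ≤ n) (hodd : Odd n) :
    (ArithmeticFunction.sigma 1 n : ℝ) <
      (2 / 3) * Real.exp Real.eulerMascheroniConstant * (n : ℝ) *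
        Real.log (Real.log (2 * n : ℕ)) := by
  have hn' : (0 : ℝ) < n := by exact_mod_cast (show 0 < n by omega)
  have h1 : (ArithmeticFunction.sigma 1 n : ℝ) <
      7 / 6 * n * Real.log (Real.log ((2 * n : ℕ) : ℝ)) := by
    rcases lt_or_ge n 360 with h | h
    · exact small_n n hn (by omega) hodd
    · exact large_n n h hodd
  have h2 : 0 ≤ Real.log (Real.log ((2 * n : ℕ) : ℝ)) := by
    have := loglog_lb (2 * n) 34 (by omega) 35 10 120 100 (by norm_num) (by norm_num) (by norm_num)
      (by norm_num) (by norm_num) (by norm_num)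
    refine le_trans ?_ this
    norm_num
  have h3 := exp_gamma_lb
  refine lt_of_lt_of_le h1 ?_
  refine mul_le_mul_of_nonneg_right ?_ h2
  refine mul_le_mul_of_nonneg_right ?_ hn'.le
  linarith
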